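/- Let τ belong to class 𝒯. Then there exists a unique absolutely continuous τ-invariant probability measure μ on I; the dynamical system (I, 𝓑, μ, τ) is exact, i.e., every Borel set A belonging to ⋂_{n≥0} τ^{-n}(𝓑) satisfies μ(A) ∈ {0,1}; and the density h = dμ/dm is bounded and non-increasing. -/

import Mathlib

open Set Filter MeasureTheory Topology

structure PCT where
  τ : ℝ → ℝ
  a : ℕ → ℝ
  b : ℕ → ℝ
  da : ℕ → ℝ
  maps_to : Set.MapsTo τ (Set.Icc 0 1) (Set.Icc 0 1)
  lt : ∀ i, a i < b i
  sub : ∀ i, Set.Ioo (a i) (b i) ⊆ Set.Icc (0:ℝ) 1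
  disj : Pairwise (Function.onFun Disjoint fun i => Set.Ioo (a i) (b i))
  null : volume (Set.Icc (0:ℝ) 1 \ ⋃ i, Set.Ioo (a i) (b i)) = 0
  mono : ∀ i, StrictMonoOn τ (Set.Ioo (a i) (b i))
  conv : ∀ i, ConvexOn ℝ (Set.Ioo (a i) (b i)) τ
  diff : ∀ i, ∀ x ∈ Set.Ioo (a i) (b i), DifferentiableAt ℝ τ x
  lim_zero : ∀ i, Filter.Tendsto τ (nhdsWithin (a i) (Set.Ioi (a i))) (nhds 0)
  deriv_lim : ∀ i, Filter.Tendsto (deriv τ) (nhdsWithin (a i) (Set.Ioi (a i))) (nhds (da i))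
  da_pos : ∀ i, 0 < da i
  sum_inv : Summable (fun i => 1 / da i)
  expand : (¬ AccPt (0:ℝ) (Filter.principal (Set.range a))) → ∃ i, a i = 0 ∧ 1 < da i

/-- The interval `(c,d)` follows a single sequence of branches under the first `n`
iterates of `τ`. -/
def IsBranchSeq (T : PCT) (n : ℕ) (c d : ℝ) : Prop :=
  c < d ∧ ∀ k < n, ∃ i, T.τ^[k] '' Set.Ioo c d ⊆ Set.Ioo (T.a i) (T.b i)

/-- `(c,d)` is a maximal open interval on which `τ^n` is a single monotone branch,
i.e. an element of the partition `𝒫⁽ⁿ⁾`. -/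
def IsBranchInterval (T : PCT) (n : ℕ) (c d : ℝ) : Prop :=
  IsBranchSeq T n c d ∧
    ∀ c' d', c' ≤ c → d ≤ d' → IsBranchSeq T n c' d' → c' = c ∧ d' = d

namespace PCT

variable (T : PCT)

/-- The domain of the `i`-th branch. -/
abbrev branch (i : ℕ) : Set ℝ := Ioo (T.a i) (T.b i)

/-- The union of the domains of all branches. -/
def dom : Set ℝ := ⋃ i, T.branch i

/-- A Borel measurable modification of `τ`, which vanishes outside the branches. -/
noncomputable def map : ℝ → ℝ := T.dom.indicator T.τ

/-- The `i`-th branch, extended by `0` to the left of `a i`. -/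
noncomputable def ext (i : ℕ) (y : ℝ) : ℝ := if y ≤ T.a i then 0 else T.τ y

/-- The inverse of the `i`-th branch, extended by a constant beyond its range. -/
noncomputable def inv (i : ℕ) (x : ℝ) : ℝ := sSup {y ∈ Ico (T.a i) (T.b i) | T.ext i y ≤ x}

lemma branch_subset_dom (i : ℕ) : T.branch i ⊆ T.dom := subset_iUnion T.branch i

lemma isOpen_dom : IsOpen T.dom := isOpen_iUnion fun _ => isOpen_Ioo

lemma dom_subset : T.dom ⊆ Icc 0 1 := iUnion_subset T.sub

lemma a_nonneg (i : ℕ) : 0 ≤ T.a i := by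
  have h := closure_mono (T.sub i)
  rw [closure_Ioo (T.lt i).ne, isClosed_Icc.closure_eq] at h
  exact (h (left_mem_Icc.2 (T.lt i).le)).1

lemma b_le_one (i : ℕ) : T.b i ≤ 1 := by
  have h := closure_mono (T.sub i)
  rw [closure_Ioo (T.lt i).ne, isClosed_Icc.closure_eq] at h
  exact (h (right_mem_Icc.2 (T.lt i).le)).2

lemma map_of_mem {x : ℝ} (hx : x ∈ T.dom) : T.map x = T.τ x := indicator_of_mem hx _

lemma map_of_mem_branch {i : ℕ} {x : ℝ} (hx : x ∈ T.branch i) : T.map x = T.τ x :=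
  T.map_of_mem (T.branch_subset_dom i hx)

lemma map_mem (x : ℝ) : T.map x ∈ Icc (0 : ℝ) 1 := by
  by_cases hx : x ∈ T.dom
  · rw [T.map_of_mem hx]
    exact T.maps_to (T.dom_subset hx)
  · simp [map, hx]

lemma measurable_map : Measurable T.map := by
  classical
  have hc : ContinuousOn T.τ T.dom := fun x hx => by
    obtain ⟨i, hi⟩ := mem_iUnion.1 hx
    exact (T.diff i x hi).continuousAt.continuousWithinAt
  have := hc.measurable_piecewise (continuousOn_const (c := (0 : ℝ)) (s := T.domᶜ))
    T.isOpen_dom.measurableSet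
  convert this using 1
  exact (piecewise_eq_indicator).symm

lemma strictMonoOn_map (i : ℕ) : StrictMonoOn T.map (T.branch i) :=
  (T.mono i).congr fun _ hx => (T.map_of_mem_branch hx).symm

lemma ext_a (i : ℕ) : T.ext i (T.a i) = 0 := if_pos le_rfl

lemma ext_of_lt {i : ℕ} {y : ℝ} (hy : T.a i < y) : T.ext i y = T.τ y := if_neg hy.not_ge

lemma tendsto_ext {i : ℕ} {x : ℝ} (hx : x ∈ Ico (T.a i) (T.b i)) :
    Tendsto (T.ext i) (𝓝[>] x) (𝓝 (T.ext i x)) := by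
  have hev : T.τ =ᶠ[𝓝[>] x] T.ext i := by
    filter_upwards [self_mem_nhdsWithin] with y hy
    exact (T.ext_of_lt (hx.1.trans_lt hy)).symm
  refine Tendsto.congr' hev ?_
  rcases hx.1.eq_or_lt with h | h
  · rw [← h, T.ext_a]
    exact T.lim_zero i
  · rw [T.ext_of_lt h]
    exact (T.diff i x ⟨h, hx.2⟩).continuousAt.continuousWithinAt

lemma convexOn_ext (i : ℕ) : ConvexOn ℝ (Ico (T.a i) (T.b i)) (T.ext i) := by
  have shift : ∀ x ∈ Ico (T.a i) (T.b i),
      Tendsto (fun ε => T.ext i (x + ε)) (𝓝[>] 0) (𝓝 (T.ext i x)) := fun x hx => by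
    refine (T.tendsto_ext hx).comp (tendsto_nhdsWithin_iff.2 ⟨?_, ?_⟩)
    · exact ((continuous_const_add x).tendsto' 0 x (add_zero x)).mono_left nhdsWithin_le_nhds
    · filter_upwards [self_mem_nhdsWithin] with ε hε
      exact lt_add_of_pos_right x hε
  have inside : ∀ x ∈ Ico (T.a i) (T.b i), ∀ᶠ ε in 𝓝[>] (0 : ℝ), x + ε ∈ T.branch i :=
    fun x hx => by
      filter_upwards [Ioo_mem_nhdsGT (sub_pos.2 hx.2)] with ε hε
      exact ⟨by linarith [hx.1, hε.1], by linarith [hε.2]⟩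
  refine ⟨convex_Ico _ _, fun x hx y hy t s ht hs hts => ?_⟩
  have hz := convex_Ico (T.a i) (T.b i) hx hy ht hs hts
  refine le_of_tendsto_of_tendsto (shift _ hz)
    (((shift x hx).const_smul t).add ((shift y hy).const_smul s)) ?_
  filter_upwards [inside x hx, inside y hy, inside _ hz] with ε h1 h2 h3
  have key := (T.conv i).2 h1 h2 ht hs hts
  have e : t • (x + ε) + s • (y + ε) = t • x + s • y + ε := by
    simp only [smul_eq_mul]
    linear_combination ε * hts
  rw [T.ext_of_lt h1.1, T.ext_of_lt h2.1, T.ext_of_lt h3.1, ← e]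
  exact key

lemma da_le_deriv {i : ℕ} {x : ℝ} (hx : x ∈ T.branch i) : T.da i ≤ deriv T.τ x := by
  refine le_of_tendsto (T.deriv_lim i) ?_
  filter_upwards [Ioo_mem_nhdsGT hx.1] with y hy
  exact (T.conv i).monotoneOn_deriv (fun z hz => T.diff i z hz) ⟨hy.1, hy.2.trans hx.2⟩ hx hy.2.le

lemma da_mul_le_ext {i : ℕ} {y : ℝ} (hy : y ∈ Ico (T.a i) (T.b i)) :
    T.da i * (y - T.a i) ≤ T.ext i y := by
  have hev : ∀ x ∈ T.branch i, T.ext i =ᶠ[𝓝 x] T.τ := fun x hx => by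
    filter_upwards [isOpen_Ioo.mem_nhds hx] with z hz
    exact T.ext_of_lt hz.1
  have hd : ∀ x ∈ T.branch i, DifferentiableAt ℝ (T.ext i) x := fun x hx =>
    (hev x hx).symm.differentiableAt_iff.1 (T.diff i x hx)
  have key := (convex_Ico (T.a i) (T.b i)).mul_sub_le_image_sub_of_le_deriv (f := T.ext i)
    (C := T.da i) ?_ ?_ ?_ (T.a i) (left_mem_Ico.2 (T.lt i)) y hy hy.1
  · simpa [T.ext_a] using key
  · intro x hx
    rcases hx.1.eq_or_lt with h | h
    · have h1 := T.tendsto_ext hx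
      have : ContinuousWithinAt (T.ext i) (Ici x) x := by
        rw [← continuousWithinAt_Ioi_iff_Ici]
        exact h1
      exact this.mono fun z hz => h ▸ hz.1
    · exact (hd x ⟨h, hx.2⟩).continuousAt.continuousWithinAt
  · rw [interior_Ico]
    exact fun x hx => (hd x hx).differentiableWithinAt
  · rw [interior_Ico]
    exact fun x hx => by
      rw [(hev x hx).deriv_eq]
      exact T.da_le_deriv hx

lemma bddAbove_inv (i : ℕ) (x : ℝ) : BddAbove {y ∈ Ico (T.a i) (T.b i) | T.ext i y ≤ x} :=
  ⟨T.b i, fun _ hy => hy.1.2.le⟩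

lemma nonempty_inv (i : ℕ) {x : ℝ} (hx : 0 ≤ x) :
    {y ∈ Ico (T.a i) (T.b i) | T.ext i y ≤ x}.Nonempty :=
  ⟨T.a i, left_mem_Ico.2 (T.lt i), (T.ext_a i).trans_le hx⟩

lemma a_le_inv (i : ℕ) {x : ℝ} (hx : 0 ≤ x) : T.a i ≤ T.inv i x :=
  le_csSup (T.bddAbove_inv i x) ⟨left_mem_Ico.2 (T.lt i), (T.ext_a i).trans_le hx⟩

lemma inv_le_b (i : ℕ) {x : ℝ} (hx : 0 ≤ x) : T.inv i x ≤ T.b i :=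
  csSup_le (T.nonempty_inv i hx) fun _ hy => hy.1.2.le

lemma inv_nonneg (i : ℕ) {x : ℝ} (hx : 0 ≤ x) : 0 ≤ T.inv i x :=
  (T.a_nonneg i).trans (T.a_le_inv i hx)

lemma inv_sub_a_le (i : ℕ) {x : ℝ} (hx : 0 ≤ x) : T.inv i x - T.a i ≤ x / T.da i := by
  rw [sub_le_iff_le_add]
  refine csSup_le (T.nonempty_inv i hx) fun y hy => ?_
  have := (T.da_mul_le_ext hy.1).trans hy.2
  rw [← sub_le_iff_le_add, le_div_iff₀ (T.da_pos i)]
  linarith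

lemma concaveOn_inv (i : ℕ) : ConcaveOn ℝ (Ici 0) (T.inv i) := by
  refine ⟨convex_Ici 0, fun x hx y hy t s ht hs hts => ?_⟩
  simp only [inv, smul_eq_mul]
  rw [← smul_eq_mul, ← smul_eq_mul, ← Real.sSup_smul_of_nonneg ht,
    ← Real.sSup_smul_of_nonneg hs, ← csSup_add ((T.nonempty_inv i hx).smul_set)
      ((T.bddAbove_inv i x).smul_of_nonneg ht) ((T.nonempty_inv i hy).smul_set)
      ((T.bddAbove_inv i y).smul_of_nonneg hs)]
  refine csSup_le_csSup (T.bddAbove_inv i _)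
    ((T.nonempty_inv i hx).smul_set.add (T.nonempty_inv i hy).smul_set) ?_
  rintro _ ⟨_, ⟨u, hu, rfl⟩, _, ⟨v, hv, rfl⟩, rfl⟩
  refine ⟨convex_Ico _ _ hu.1 hv.1 ht hs hts, ((T.convexOn_ext i).2 hu.1 hv.1 ht hs hts).trans ?_⟩
  simp only [smul_eq_mul]
  exact add_le_add (mul_le_mul_of_nonneg_left hu.2 ht) (mul_le_mul_of_nonneg_left hv.2 hs)

lemma Ioo_inv_subset (i : ℕ) {x : ℝ} (hx : 0 ≤ x) :
    Ioo (T.a i) (T.inv i x) ⊆ T.map ⁻¹' Iic x ∩ T.branch i := by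
  intro y hy
  have hyb : y ∈ T.branch i := ⟨hy.1, hy.2.trans_le (T.inv_le_b i hx)⟩
  refine ⟨?_, hyb⟩
  obtain ⟨z, hz, hyz⟩ := exists_lt_of_lt_csSup (T.nonempty_inv i hx) hy.2
  have haz : T.a i < z := hy.1.trans hyz
  have h := hz.2
  rw [T.ext_of_lt haz] at h
  rw [mem_preimage, mem_Iic, T.map_of_mem_branch hyb]
  exact (T.mono i hyb ⟨haz, hz.1.2⟩ hyz).le.trans h

lemma subset_Ioc_inv (i : ℕ) (x : ℝ) :
    T.map ⁻¹' Iic x ∩ T.branch i ⊆ Ioc (T.a i) (T.inv i x) := by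
  rintro y ⟨hy, hyb⟩
  refine ⟨hyb.1, le_csSup (T.bddAbove_inv i x) ⟨⟨hyb.1.le, hyb.2⟩, ?_⟩⟩
  rw [T.ext_of_lt hyb.1, ← T.map_of_mem_branch hyb]
  exact hy

/-- Lebesgue measure on the unit interval. -/
noncomputable abbrev leb : Measure ℝ := volume.restrict (Icc 0 1)

lemma leb_compl_dom : leb T.domᶜ = 0 := by
  rw [Measure.restrict_apply T.isOpen_dom.measurableSet.compl, inter_comm, ← sdiff_eq]
  exact T.null

lemma quasiMeasurePreserving_map : Measure.QuasiMeasurePreserving T.map leb leb := by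
  refine ⟨T.measurable_map, Measure.AbsolutelyContinuous.mk fun N hN hN0 => ?_⟩
  rw [Measure.map_apply T.measurable_map hN]
  have hvol : volume (N ∩ Icc 0 1) = 0 := by rwa [Measure.restrict_apply hN] at hN0
  have hbranch : ∀ i, volume (T.map ⁻¹' N ∩ T.branch i) = 0 := fun i => by
    have hms : MeasurableSet (T.map ⁻¹' N ∩ T.branch i) :=
      (T.measurable_map hN).inter measurableSet_Ioo
    have himg : volume (T.τ '' (T.map ⁻¹' N ∩ T.branch i)) = 0 := by
      refine measure_mono_null ?_ hvol
      rintro _ ⟨y, ⟨hy, hyb⟩, rfl⟩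
      rw [← T.map_of_mem_branch hyb]
      exact ⟨hy, T.map_mem y⟩
    have key := lintegral_image_eq_lintegral_abs_deriv_mul hms
      (fun x hx => (T.diff i x hx.2).hasDerivAt.hasDerivWithinAt)
      ((T.mono i).injOn.mono inter_subset_right) (fun _ => 1)
    rw [Measure.restrict_eq_zero.2 himg, lintegral_zero_measure] at key
    by_contra hne
    have hpos : 0 < ENNReal.ofReal (T.da i) * volume (T.map ⁻¹' N ∩ T.branch i) :=
      ENNReal.mul_pos (ENNReal.ofReal_pos.2 (T.da_pos i)).ne' hne
    refine absurd key (ne_of_lt (hpos.trans_le ?_))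
    rw [← setLIntegral_const]
    refine setLIntegral_mono' hms fun x hx => ?_
    rw [mul_one]
    exact ENNReal.ofReal_le_ofReal ((T.da_le_deriv hx.2).trans (le_abs_self _))
  have hdom : volume (T.map ⁻¹' N ∩ T.dom) = 0 := by
    rw [dom, inter_iUnion]
    exact measure_iUnion_null hbranch
  refine measure_mono_null (t := T.map ⁻¹' N ∩ T.dom ∪ T.domᶜ) (fun x hx => ?_)
    (measure_union_null (Measure.restrict_le_self.absolutelyContinuous hdom) T.leb_compl_dom)
  by_cases h : x ∈ T.dom
  · exact Or.inl ⟨hx, h⟩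
  · exact Or.inr h

variable {T}
variable {ν : Measure ℝ}

lemma map_absolutelyContinuous (hν : ν ≪ leb) : ν.map T.map ≪ leb :=
  (hν.map T.measurable_map).trans T.quasiMeasurePreserving_map.absolutelyContinuous

lemma nullMeasure_singleton (hν : ν ≪ leb) (x : ℝ) : ν {x} = 0 :=
  hν (Measure.restrict_le_self.absolutelyContinuous Real.volume_singleton)

lemma measure_Iic_eq_zero (hν : ν ≪ leb) {x : ℝ} (hx : x ≤ 0) : ν (Iic x) = 0 := by
  refine measure_mono_null (Iic_subset_Iic.2 hx) (hν ?_)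
  rw [Measure.restrict_apply measurableSet_Iic]
  exact measure_mono_null (fun y hy => le_antisymm hy.1 hy.2.1) (Real.volume_singleton (a := 0))

lemma measureReal_Iic_eq_univ (hν : ν ≪ leb) {x : ℝ} (hx : 1 ≤ x) :
    ν.real (Iic x) = ν.real univ := by
  refine measureReal_congr (eventuallyEq_univ.2 (mem_ae_iff.2 (hν ?_)))
  rw [Measure.restrict_apply measurableSet_Iic.compl]
  convert measure_empty (μ := volume)
  ext y
  simp only [mem_inter_iff, mem_compl_iff, mem_Iic, mem_Icc, mem_empty_iff_false, iff_false]
  rintro ⟨h1, h2, h3⟩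
  linarith

lemma measureReal_Ioc [IsFiniteMeasure ν] {x y : ℝ} (h : x ≤ y) :
    ν.real (Ioc x y) = ν.real (Iic y) - ν.real (Iic x) := by
  rw [← Iic_sdiff_Iic, measureReal_sdiff (Iic_subset_Iic.2 h) measurableSet_Iic]

lemma monotone_measureReal_Iic [IsFiniteMeasure ν] : Monotone fun x => ν.real (Iic x) :=
  fun _ _ h => measureReal_mono (Iic_subset_Iic.2 h)

lemma restrict_branch_map_Iic [IsFiniteMeasure ν] (hν : ν ≪ leb) (i : ℕ) {x : ℝ} (hx : 0 ≤ x) :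
    ((ν.restrict (T.branch i)).map T.map).real (Iic x) =
      ν.real (Iic (T.inv i x)) - ν.real (Iic (T.a i)) := by
  rw [← measureReal_Ioc (T.a_le_inv i hx), map_measureReal_apply T.measurable_map measurableSet_Iic,
    measureReal_restrict_apply (T.measurable_map measurableSet_Iic)]
  refine le_antisymm (measureReal_mono (T.subset_Ioc_inv i x)) ?_
  have : ν.real (Ioc (T.a i) (T.inv i x)) = ν.real (Ioo (T.a i) (T.inv i x)) := by
    refine measureReal_congr ?_
    have : NullSingletonClass ν := ⟨nullMeasure_singleton hν⟩
    exact Ioo_ae_eq_Ioc.symm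
  rw [this]
  exact measureReal_mono (T.Ioo_inv_subset i hx)

lemma map_eq_sum (hν : ν ≪ leb) :
    ν.map T.map = Measure.sum fun i => (ν.restrict (T.branch i)).map T.map := by
  have h : ν = Measure.sum fun i => ν.restrict (T.branch i) := by
    rw [← Measure.restrict_iUnion T.disj fun _ => measurableSet_Ioo]
    exact (Measure.restrict_eq_self_of_ae_mem (hν T.leb_compl_dom)).symm
  conv_lhs => rw [h]
  exact Measure.map_sum T.measurable_map.aemeasurable

lemma hasSum_map_Iic [IsFiniteMeasure ν] (hν : ν ≪ leb) {x : ℝ} (hx : 0 ≤ x) :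
    HasSum (fun i => ν.real (Iic (T.inv i x)) - ν.real (Iic (T.a i)))
      ((ν.map T.map).real (Iic x)) := by
  simp_rw [← restrict_branch_map_Iic hν _ hx]
  have h : (ν.map T.map) (Iic x) = ∑' i, ((ν.restrict (T.branch i)).map T.map) (Iic x) := by
    conv_lhs => rw [map_eq_sum hν]
    exact Measure.sum_apply _ measurableSet_Iic
  have hne : ∑' i, ((ν.restrict (T.branch i)).map T.map) (Iic x) ≠ ⊤ := h ▸ measure_ne_top _ _
  simp only [measureReal_def, h]
  rw [ENNReal.tsum_toReal_eq (ENNReal.ne_top_of_tsum_ne_top hne)]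
  exact (ENNReal.summable_toReal hne).hasSum

/-- `ν` has a non-increasing density with respect to Lebesgue measure on the unit interval, and this
density is bounded by `L`; both properties are expressed through the distribution function. -/
structure HasDecreasingDensity (ν : Measure ℝ) (L : ℝ) : Prop where
  finite : IsFiniteMeasure ν
  ac : ν ≪ leb
  concave : ConcaveOn ℝ (Ici 0) fun x => ν.real (Iic x)
  le_mul : ∀ x, 0 ≤ x → ν.real (Iic x) ≤ L * x

namespace HasDecreasingDensity

variable {L : ℝ}

lemma mono (h : HasDecreasingDensity ν L) {L' : ℝ} (hL : L ≤ L') : HasDecreasingDensity ν L' :=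
  ⟨h.finite, h.ac, h.concave, fun x hx =>
    (h.le_mul x hx).trans (mul_le_mul_of_nonneg_right hL hx)⟩

lemma measureReal_univ_le (h : HasDecreasingDensity ν L) : ν.real univ ≤ L := by
  simpa [measureReal_Iic_eq_univ h.ac le_rfl] using h.le_mul 1 zero_le_one

lemma nonneg (h : HasDecreasingDensity ν L) : 0 ≤ L :=
  measureReal_nonneg.trans h.measureReal_univ_le

lemma sub_le_slope (h : HasDecreasingDensity ν L) {x y : ℝ} (hx : 0 < x) (hxy : x ≤ y) :
    ν.real (Iic y) - ν.real (Iic x) ≤ ν.real (Iic x) / x * (y - x) := by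
  rcases hxy.eq_or_lt with rfl | hlt
  · simp
  have key := h.concave.slope_anti_adjacent (self_mem_Ici (a := (0 : ℝ)))
    (mem_Ici.2 (hx.le.trans hxy)) hx hlt
  simp only [measureReal_def (s := Iic (0 : ℝ)), measure_Iic_eq_zero h.ac le_rfl,
    ENNReal.toReal_zero, sub_zero] at key
  rwa [div_le_iff₀ (sub_pos.2 hlt)] at key

lemma sub_le (h : HasDecreasingDensity ν L) {x y : ℝ} (hx : 0 ≤ x) (hxy : x ≤ y) :
    ν.real (Iic y) - ν.real (Iic x) ≤ L * (y - x) := by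
  rcases hx.eq_or_lt with rfl | hpos
  · simpa [measureReal_def (s := Iic (0 : ℝ)), measure_Iic_eq_zero h.ac le_rfl]
      using h.le_mul y hxy
  · refine (h.sub_le_slope hpos hxy).trans (mul_le_mul_of_nonneg_right ?_ (sub_nonneg.2 hxy))
    exact (div_le_iff₀ hpos).2 (h.le_mul x hx)

lemma sub_le_of_pos (h : HasDecreasingDensity ν L) {x y : ℝ} (hx : 0 < x) (hxy : x ≤ y) :
    ν.real (Iic y) - ν.real (Iic x) ≤ ν.real univ / x * (y - x) := by
  have := h.finite
  refine (h.sub_le_slope hx hxy).trans (mul_le_mul_of_nonneg_right ?_ (sub_nonneg.2 hxy))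
  exact div_le_div_of_nonneg_right (measureReal_mono (subset_univ _)) hx.le

lemma inv_sub_le (i : ℕ) {s x : ℝ} (hs : 0 ≤ s)
    (h : ∀ y, T.a i ≤ y → ν.real (Iic y) - ν.real (Iic (T.a i)) ≤ s * (y - T.a i)) (hx : 0 ≤ x) :
    ν.real (Iic (T.inv i x)) - ν.real (Iic (T.a i)) ≤ 1 / T.da i * s * x := by
  refine (h _ (T.a_le_inv i hx)).trans ?_
  refine (mul_le_mul_of_nonneg_left (T.inv_sub_a_le i hx) hs).trans_eq ?_
  ring

lemma concave_inv (h : HasDecreasingDensity ν L) (i : ℕ) :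
    ConcaveOn ℝ (Ici 0) fun x => ν.real (Iic (T.inv i x)) - ν.real (Iic (T.a i)) := by
  have := h.finite
  have hc : ConcaveOn ℝ (Ici 0) ((fun x => ν.real (Iic x)) ∘ T.inv i) := by
    refine ⟨convex_Ici 0, fun x hx y hy t s ht hs hts => ?_⟩
    exact (h.concave.2 (T.inv_nonneg i hx) (T.inv_nonneg i hy) ht hs hts).trans
      (monotone_measureReal_Iic ((T.concaveOn_inv i).2 hx hy ht hs hts))
  exact (hc.add_const (-ν.real (Iic (T.a i)))).congr fun x _ => (sub_eq_add_neg _ _).symm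

lemma map_restrict (h : HasDecreasingDensity ν L) (i : ℕ) :
    HasDecreasingDensity ((ν.restrict (T.branch i)).map T.map) (1 / T.da i * L) := by
  have := h.finite
  refine ⟨inferInstance,
    map_absolutelyContinuous (Measure.restrict_le_self.absolutelyContinuous.trans h.ac), ?_, ?_⟩
  · exact (h.concave_inv i).congr fun x hx => (restrict_branch_map_Iic h.ac i hx).symm
  · intro x hx
    rw [restrict_branch_map_Iic h.ac i hx]
    exact inv_sub_le i h.nonneg (fun y hy => h.sub_le (T.a_nonneg i) hy) hx

end HasDecreasingDensity

lemma b_le_a_of_a_eq_zero {i j : ℕ} (hi : T.a i = 0) (hij : j ≠ i) : T.b i ≤ T.a j := by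
  by_contra! hlt
  obtain ⟨z, hz1, hz2⟩ := exists_between (lt_min hlt (T.lt j))
  refine disjoint_left.1 (T.disj hij) ⟨hz1, hz2.trans_le (min_le_right _ _)⟩
    ⟨?_, hz2.trans_le (min_le_left _ _)⟩
  rw [hi]
  exact (T.a_nonneg j).trans_lt hz1

lemma a_pos_of_accPt (h : AccPt (0 : ℝ) (𝓟 (range T.a))) (i : ℕ) : 0 < T.a i := by
  refine (T.a_nonneg i).lt_of_ne' fun hi => ?_
  rw [accPt_iff_nhds] at h
  have hb : 0 < T.b i := hi ▸ T.lt i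
  obtain ⟨_, ⟨hy1, j, rfl⟩, hy2⟩ := h (Iio (T.b i)) (Iio_mem_nhds hb)
  have hji : j ≠ i := by
    rintro rfl
    exact hy2 hi
  exact absurd (b_le_a_of_a_eq_zero hi hji) (not_le.2 hy1)

variable (T) in
lemma exists_finset_tsum_lt_one : ∃ s : Finset ℕ, (∀ i ∈ s, 0 < T.a i) ∧
    ∑' i, ((s : Set ℕ)ᶜ).indicator (fun i => 1 / T.da i) i < 1 := by
  have htail : ∀ ε > 0, ∃ s : Finset ℕ,
      ∑' i, ((s : Set ℕ)ᶜ).indicator (fun i => 1 / T.da i) i < ε := fun ε hε => by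
    have h := tendsto_tsum_compl_atTop_zero fun i => 1 / T.da i
    obtain ⟨s, hs⟩ := (h.eventually_lt_const hε).exists
    refine ⟨s, ?_⟩
    rw [← tsum_subtype]
    exact hs
  by_cases hacc : AccPt (0 : ℝ) (𝓟 (range T.a))
  · obtain ⟨s, hs⟩ := htail 1 one_pos
    exact ⟨s, fun i _ => a_pos_of_accPt hacc i, hs⟩
  · obtain ⟨k, hk0, hk1⟩ := T.expand hacc
    obtain ⟨s, hs⟩ := htail (1 - 1 / T.da k) (by
      rw [gt_iff_lt, sub_pos, div_lt_one (T.da_pos k)]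
      exact hk1)
    refine ⟨s.erase k, fun i hi => ?_, ?_⟩
    · exact ((hk0 ▸ T.lt k).trans_le (b_le_a_of_a_eq_zero hk0 (Finset.ne_of_mem_erase hi)))
    · have hsum : HasSum (fun i => ((s : Set ℕ)ᶜ).indicator (fun i => 1 / T.da i) i +
          if i = k then 1 / T.da k else 0)
          (∑' i, ((s : Set ℕ)ᶜ).indicator (fun i => 1 / T.da i) i + 1 / T.da k) :=
        (T.sum_inv.indicator _).hasSum.add (hasSum_ite_eq k _)
      refine (hasSum_le (fun i => ?_) (T.sum_inv.indicator _).hasSum hsum).trans_lt (by linarith)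
      by_cases hik : i = k
      · subst hik
        by_cases his : i ∈ s <;> simp [indicator, his, (T.da_pos i).le]
      · by_cases his : i ∈ s <;> simp [indicator, his, hik]

/-- Summing concave functions over the branches preserves non-increasing densities, with a bound
given by the sum of the slopes of the increments. -/
lemma HasDecreasingDensity.map_of_hasSum {L M : ℝ} {w : ℕ → ℝ} (h : HasDecreasingDensity ν L)
    (hw : HasSum w M)
    (hle : ∀ i x, 0 ≤ x → ν.real (Iic (T.inv i x)) - ν.real (Iic (T.a i)) ≤ w i * x) :
    HasDecreasingDensity (ν.map T.map) M := by
  have := h.finite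
  refine ⟨inferInstance, map_absolutelyContinuous h.ac, ⟨convex_Ici 0, ?_⟩, ?_⟩
  · intro x hx y hy t s ht hs hts
    have hz : (0 : ℝ) ≤ t • x + s • y := convex_Ici 0 hx hy ht hs hts
    exact hasSum_le (fun i => (h.concave_inv i).2 hx hy ht hs hts)
      (((hasSum_map_Iic h.ac hx).const_smul t).add ((hasSum_map_Iic h.ac hy).const_smul s))
      (hasSum_map_Iic h.ac hz)
  · intro x hx
    exact hasSum_le (fun i => hle i x hx) (hasSum_map_Iic h.ac hx) (hw.mul_right x)

variable (T) in
/-- A Lasota–Yorke inequality for non-increasing densities. -/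
lemma exists_lasotaYorke : ∃ (s : Finset ℕ) (α K : ℝ), (∀ i ∈ s, 0 < T.a i) ∧ 0 ≤ α ∧ α < 1 ∧
    0 ≤ K ∧ (∀ i ∉ s, 1 / T.da i ≤ α) ∧ ∀ (ν : Measure ℝ) (L : ℝ), HasDecreasingDensity ν L →
      HasDecreasingDensity (ν.map T.map) (α * L + K * ν.real univ) := by
  obtain ⟨s, hs, hlt⟩ := T.exists_finset_tsum_lt_one
  have hd : ∀ i, 0 < 1 / T.da i := fun i => one_div_pos.2 (T.da_pos i)
  have hsum := T.sum_inv.indicator ((s : Set ℕ)ᶜ)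
  have hnonneg : ∀ i, 0 ≤ ((s : Set ℕ)ᶜ).indicator (fun i => 1 / T.da i) i :=
    indicator_nonneg fun i _ => (hd i).le
  have hKsum : HasSum (fun i => (s : Set ℕ).indicator (fun i => 1 / T.da i * (1 / T.a i)) i)
      (∑ i ∈ s, 1 / T.da i * (1 / T.a i)) := by
    have h := hasSum_sum_of_ne_finset_zero (L := SummationFilter.unconditional ℕ)
      (f := (s : Set ℕ).indicator fun i => 1 / T.da i * (1 / T.a i)) (s := s)
      fun i hi => indicator_of_notMem (by simpa using hi) _
    rwa [Finset.sum_congr rfl fun i hi => indicator_of_mem (Finset.mem_coe.2 hi) _] at h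
  refine ⟨s, _, ∑ i ∈ s, 1 / T.da i * (1 / T.a i), hs, tsum_nonneg hnonneg, hlt,
    Finset.sum_nonneg fun i hi => mul_nonneg (hd i).le (one_div_pos.2 (hs i hi)).le,
    fun i hi => ?_, fun ν L h => ?_⟩
  · have := hsum.le_tsum i fun j _ => hnonneg j
    rwa [indicator_of_mem (by simpa using hi)] at this
  · refine h.map_of_hasSum ((hsum.hasSum.mul_right L).add (hKsum.mul_right _)) fun i x hx => ?_
    by_cases hi : i ∈ s
    · have := HasDecreasingDensity.inv_sub_le (T := T) i
        (div_nonneg measureReal_nonneg (hs i hi).le) (fun y hy => h.sub_le_of_pos (hs i hi) hy) hx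
      refine this.trans_eq ?_
      simp only [indicator, Finset.mem_coe, mem_compl_iff, hi, not_true_eq_false, if_false, if_true]
      ring
    · have := HasDecreasingDensity.inv_sub_le (T := T) i h.nonneg
        (fun y hy => h.sub_le (T.a_nonneg i) hy) hx
      refine this.trans_eq ?_
      simp only [indicator, Finset.mem_coe, mem_compl_iff, hi, not_false_eq_true, if_false, if_true]
      ring

lemma hasDecreasingDensity_leb : HasDecreasingDensity leb 1 := by
  have hF : ∀ x : ℝ, 0 ≤ x → leb.real (Iic x) = min x 1 := fun x hx => by
    rw [measureReal_restrict_apply measurableSet_Iic]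
    have : Iic x ∩ Icc 0 1 = Icc 0 (min x 1) := by
      ext y
      simp only [mem_inter_iff, mem_Iic, mem_Icc, le_min_iff]
      tauto
    rw [this, Real.volume_real_Icc_of_le (le_min hx zero_le_one), sub_zero]
  refine ⟨inferInstance, Measure.AbsolutelyContinuous.rfl, ?_, fun x hx => ?_⟩
  · refine ConcaveOn.congr (f := fun x : ℝ => min x 1) ?_ fun x hx => (hF x hx).symm
    exact (concaveOn_id (convex_Ici 0)).inf (concaveOn_const 1 (convex_Ici 0))
  · rw [hF x hx, one_mul]
    exact min_le_left _ _

lemma map_iterate_succ (n : ℕ) : ν.map T.map^[n + 1] = (ν.map T.map^[n]).map T.map := by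
  rw [Measure.map_map T.measurable_map (T.measurable_map.iterate n), Function.iterate_succ']

lemma measureReal_univ_map_iterate (n : ℕ) : (ν.map T.map^[n]).real univ = ν.real univ := by
  rw [map_measureReal_apply (T.measurable_map.iterate n) MeasurableSet.univ, preimage_univ]

variable (T) in
lemma exists_uniform_bound : ∃ M : ℝ, 1 ≤ M ∧
    (∀ n, HasDecreasingDensity (leb.map T.map^[n]) M) ∧
    ∀ (ν : Measure ℝ) (L : ℝ), HasDecreasingDensity ν L → 0 < ν.real univ →
      ∀ᶠ n in atTop, HasDecreasingDensity (ν.map T.map^[n]) (M * ν.real univ) := by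
  obtain ⟨s, α, K, -, hα0, hα1, hK, -, hLY⟩ := T.exists_lasotaYorke
  have h1α : 0 < 1 - α := sub_pos.2 hα1
  have hstep : ∀ (ν : Measure ℝ) (L : ℝ), HasDecreasingDensity ν L → ∀ n,
      HasDecreasingDensity (ν.map T.map^[n]) (α ^ n * L + K / (1 - α) * ν.real univ) := by
    intro ν L h n
    induction n with
    | zero =>
      refine HasDecreasingDensity.mono (L := L) ?_ ?_
      · simpa using h
      · have : 0 ≤ K / (1 - α) * ν.real univ := by positivity
        simpa using this
    | succ n ih =>
      rw [map_iterate_succ]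
      have := hLY _ _ ih
      rw [measureReal_univ_map_iterate] at this
      refine this.mono (le_of_eq ?_)
      field_simp
      ring
  refine ⟨K / (1 - α) + 1, by linarith [div_nonneg hK h1α.le], fun n => ?_, fun ν L h hp => ?_⟩
  · refine (hstep leb 1 hasDecreasingDensity_leb n).mono ?_
    have : leb.real univ = 1 := by simp [measureReal_def]
    rw [this]
    linarith [pow_le_one₀ hα0 hα1.le (n := n)]
  · have hlim : Tendsto (fun n => α ^ n * L) atTop (𝓝 0) := by
      simpa using (tendsto_pow_atTop_nhds_zero_of_lt_one hα0 hα1).mul_const L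
    filter_upwards [hlim.eventually_le_const hp] with n hn
    exact (hstep ν L h n).mono (by linarith)

variable (T) in
/-- The points whose first `n` iterates follow the branches `i 0, …, i (n - 1)`. -/
def cyl (i : ℕ → ℕ) (n : ℕ) : Set ℝ := {x | ∀ k < n, T.map^[k] x ∈ T.branch (i k)}

variable (T) in
/-- The image under the `n`-th iterate of Lebesgue measure on a cylinder of order `n`. -/
noncomputable def cylPush (i : ℕ → ℕ) (n : ℕ) : Measure ℝ :=
  (leb.restrict (T.cyl i n)).map T.map^[n]

lemma cyl_succ (i : ℕ → ℕ) (n : ℕ) :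
    T.cyl i (n + 1) = T.cyl i n ∩ T.map^[n] ⁻¹' T.branch (i n) := by
  ext x
  simp only [cyl, mem_ofPred_eq, Nat.forall_lt_succ_right]
  rfl

lemma measurableSet_cyl (i : ℕ → ℕ) (n : ℕ) : MeasurableSet (T.cyl i n) := by
  induction n with
  | zero => simp [cyl]
  | succ n ih =>
    rw [cyl_succ]
    exact ih.inter (T.measurable_map.iterate n measurableSet_Ioo)

lemma ordConnected_cyl (i : ℕ → ℕ) (n : ℕ) :
    (T.cyl i n).OrdConnected ∧ MonotoneOn T.map^[n] (T.cyl i n) := by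
  induction n with
  | zero => exact ⟨by simpa [cyl] using ordConnected_univ, fun x _ y _ h => h⟩
  | succ n ih =>
    rw [cyl_succ, Function.iterate_succ']
    refine ⟨⟨fun x hx y hy z hz => ?_⟩, fun x hx y hy h => ?_⟩
    · have hzn := ih.1.out hx.1 hy.1 hz
      exact ⟨hzn, (ih.2 hx.1 hzn hz.1).trans_lt' hx.2.1, (ih.2 hzn hy.1 hz.2).trans_lt hy.2.2⟩
    · exact (T.strictMonoOn_map (i n)).monotoneOn hx.2 hy.2 (ih.2 hx.1 hy.1 h)

lemma cylPush_succ (i : ℕ → ℕ) (n : ℕ) :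
    T.cylPush i (n + 1) = ((T.cylPush i n).restrict (T.branch (i n))).map T.map := by
  have hm := T.measurable_map.iterate n
  rw [cylPush, cylPush, Measure.restrict_map hm measurableSet_Ioo,
    Measure.restrict_restrict (hm measurableSet_Ioo), Measure.map_map T.measurable_map hm,
    cyl_succ, inter_comm, Function.iterate_succ']

lemma cylPush_real_univ (i : ℕ → ℕ) (n : ℕ) :
    (T.cylPush i n).real univ = leb.real (T.cyl i n) := by
  rw [cylPush, measureReal_univ_map_iterate, measureReal_restrict_apply_univ]

lemma exists_hasDecreasingDensity_cylPush (i : ℕ → ℕ) (n : ℕ) :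
    ∃ L, HasDecreasingDensity (T.cylPush i n) L := by
  induction n with
  | zero => exact ⟨1, by simpa [cylPush, cyl] using hasDecreasingDensity_leb⟩
  | succ n ih =>
    obtain ⟨L, hL⟩ := ih
    rw [cylPush_succ]
    exact ⟨_, hL.map_restrict (i n)⟩

lemma cyl_antitone (i : ℕ → ℕ) : Antitone (T.cyl i) :=
  fun _ _ hmn _ hx k hk => hx k (hk.trans_le hmn)

lemma a_mul_le_sub (i : ℕ → ℕ) (n : ℕ) :
    T.a (i n) * leb.real (T.cyl i n) ≤ leb.real (T.cyl i n) - leb.real (T.cyl i (n + 1)) := by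
  obtain ⟨L, hL⟩ := exists_hasDecreasingDensity_cylPush (T := T) i n
  have := hL.finite
  have ha0 := T.a_nonneg (i n)
  have ha1 : T.a (i n) ≤ 1 := (T.lt (i n)).le.trans (T.b_le_one (i n))
  have hconc : T.a (i n) * (T.cylPush i n).real univ ≤ (T.cylPush i n).real (Iic (T.a (i n))) := by
    have key := hL.concave.2 (self_mem_Ici (a := (0 : ℝ))) (mem_Ici.2 zero_le_one)
      (sub_nonneg.2 ha1) ha0 (sub_add_cancel 1 _)
    simpa [measureReal_def (s := Iic (0 : ℝ)), measure_Iic_eq_zero hL.ac le_rfl,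
      measureReal_Iic_eq_univ hL.ac le_rfl] using key
  have hbranch : (T.cylPush i n).real (T.branch (i n)) = leb.real (T.cyl i (n + 1)) := by
    rw [← cylPush_real_univ, cylPush_succ, map_measureReal_apply T.measurable_map .univ,
      preimage_univ, measureReal_restrict_apply_univ]
  have hdisj : Disjoint (Iic (T.a (i n))) (T.branch (i n)) :=
    disjoint_left.2 fun x hx hx' => (mem_Iic.1 hx).not_gt hx'.1
  have hunion := measureReal_union (μ := T.cylPush i n) hdisj measurableSet_Ioo
  have hle : (T.cylPush i n).real (Iic (T.a (i n)) ∪ T.branch (i n)) ≤ (T.cylPush i n).real univ :=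
    measureReal_mono (subset_univ _)
  rw [cylPush_real_univ] at hconc hle
  linarith

/-- The lengths of nested cylinders tend to zero. -/
lemma tendsto_leb_cyl (i : ℕ → ℕ) : Tendsto (fun n => leb.real (T.cyl i n)) atTop (𝓝 0) := by
  have hanti : Antitone fun n => leb.real (T.cyl i n) :=
    fun m n h => measureReal_mono (cyl_antitone i h)
  have hlim := tendsto_atTop_ciInf hanti ⟨0, by
    rintro _ ⟨n, rfl⟩
    exact measureReal_nonneg⟩
  set ℓ := ⨅ n, leb.real (T.cyl i n)
  have hle : ∀ n, ℓ ≤ leb.real (T.cyl i n) := fun n => hanti.le_of_tendsto hlim n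
  have hℓ0 : 0 ≤ ℓ := ge_of_tendsto' hlim fun n => measureReal_nonneg
  rcases hℓ0.eq_or_lt with h0 | hpos
  · rwa [← h0] at hlim
  exfalso
  obtain ⟨s, α, K, hs, hα0, hα1, -, hα, -⟩ := T.exists_lasotaYorke
  have hdiff : Tendsto (fun n => leb.real (T.cyl i n) - leb.real (T.cyl i (n + 1))) atTop (𝓝 0) := by
    simpa using hlim.sub (hlim.comp (tendsto_add_atTop_nat 1))
  have hev : ∀ᶠ n in atTop, ∀ j ∈ s,
      leb.real (T.cyl i n) - leb.real (T.cyl i (n + 1)) < T.a j * ℓ :=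
    (Finset.eventually_all s).2 fun j hj => hdiff.eventually_lt_const (mul_pos (hs j hj) hpos)
  obtain ⟨N, hN⟩ := eventually_atTop.1 hev
  have hnot : ∀ n ≥ N, i n ∉ s := fun n hn hmem => by
    have h1 := hN n hn (i n) hmem
    have h2 := a_mul_le_sub (T := T) i n
    have h3 := mul_le_mul_of_nonneg_left (hle n) (T.a_nonneg (i n))
    linarith
  obtain ⟨L, hL⟩ := exists_hasDecreasingDensity_cylPush (T := T) i N
  have hdec : ∀ k, HasDecreasingDensity (T.cylPush i (N + k)) (α ^ k * L) := fun k => by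
    induction k with
    | zero => simpa using hL
    | succ k ih =>
      rw [← add_assoc, cylPush_succ]
      refine (ih.map_restrict (i (N + k))).mono ?_
      rw [pow_succ', mul_assoc]
      exact mul_le_mul_of_nonneg_right (hα _ (hnot _ (Nat.le_add_right N k))) ih.nonneg
  have hzero : Tendsto (fun k => α ^ k * L) atTop (𝓝 0) := by
    simpa using (tendsto_pow_atTop_nhds_zero_of_lt_one hα0 hα1).mul_const L
  refine hpos.not_ge (ge_of_tendsto' hzero fun k => (hle (N + k)).trans ?_)
  rw [← cylPush_real_univ]
  exact (hdec k).measureReal_univ_le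

variable (T) in
/-- The points which lie in the same branches as `c` for the first `n` iterates. -/
def sameCyl (c : ℝ) (n : ℕ) : Set ℝ :=
  {x | ∀ k < n, ∃ j, T.map^[k] x ∈ T.branch j ∧ T.map^[k] c ∈ T.branch j}

lemma eq_of_mem_branch {x : ℝ} {i j : ℕ} (hi : x ∈ T.branch i) (hj : x ∈ T.branch j) : i = j := by
  by_contra h
  exact disjoint_left.1 (T.disj h) hi hj

lemma tendsto_leb_sameCyl (c : ℝ) : Tendsto (fun n => leb (T.sameCyl c n)) atTop (𝓝 0) := by
  by_cases h : ∀ k, ∃ j, T.map^[k] c ∈ T.branch j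
  · choose i hi using h
    have heq : ∀ n, T.sameCyl c n = T.cyl i n := fun n => by
      ext x
      refine ⟨fun hx k hk => ?_, fun hx k hk => ⟨i k, hx k hk, hi k⟩⟩
      obtain ⟨j, hj, hj'⟩ := hx k hk
      rwa [eq_of_mem_branch (hi k) hj']
    simp_rw [heq]
    rw [← ENNReal.tendsto_toReal_iff (fun n => measure_ne_top _ _) ENNReal.zero_ne_top]
    exact tendsto_leb_cyl i
  · push Not at h
    obtain ⟨k, hk⟩ := h
    refine tendsto_const_nhds.congr' ?_
    filter_upwards [eventually_gt_atTop k] with n hn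
    rw [eq_comm, measure_eq_zero_iff_ae_notMem]
    refine Eventually.of_forall fun x hx => ?_
    obtain ⟨j, -, hj⟩ := hx k hn
    exact hk j hj

lemma measure_le_of_forall_Icc {ρ ν : Measure ℝ} [IsFiniteMeasure ρ] [IsFiniteMeasure ν]
    (h : ∀ c d, c ≤ d → ρ (Icc c d) ≤ ν (Icc c d)) (s : Set ℝ) : ρ s ≤ ν s := by
  refine (Besicovitch.vitaliFamily ρ).measure_le_of_frequently_le ν Measure.AbsolutelyContinuous.rfl
    s fun x _ => (Besicovitch.tendsto_filterAt ρ x).frequently (Eventually.frequently ?_)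
  filter_upwards [self_mem_nhdsWithin] with r hr
  rw [Real.closedBall_eq_Icc]
  exact h _ _ (by linarith [mem_Ioi.1 hr])

/-- A measure with a bounded non-increasing density is bounded below near `0`. -/
lemma HasDecreasingDensity.le_measure {M : ℝ} (hM : 1 ≤ M)
    (h : HasDecreasingDensity ν (M * ν.real univ)) (B : Set ℝ) (hB : MeasurableSet B) :
    ENNReal.ofReal (ν.real univ / 2) * volume (B ∩ Ioc 0 (1 / (2 * M))) ≤ ν B := by
  have := h.finite
  set p := ν.real univ with hp
  have hp0 : 0 ≤ p := measureReal_nonneg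
  have hM0 : 0 < M := one_pos.trans_le hM
  have hδ : 1 / (2 * M) < 1 := by
    rw [div_lt_one (by positivity)]
    linarith
  have hincr : ∀ x y, 0 ≤ x → x ≤ y → y ≤ 1 / (2 * M) →
      p / 2 * (y - x) ≤ ν.real (Iic y) - ν.real (Iic x) := by
    intro x y hx hxy hy
    rcases hxy.eq_or_lt with rfl | hlt
    · simp
    have hy1 : y < 1 := hy.trans_lt hδ
    have key := h.concave.slope_anti_adjacent (mem_Ici.2 hx) (mem_Ici.2 zero_le_one) hlt hy1
    simp only [measureReal_Iic_eq_univ h.ac le_rfl] at key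
    rw [← le_div_iff₀ (sub_pos.2 hlt)]
    refine le_trans ?_ key
    have hFy : ν.real (Iic y) ≤ p / 2 := by
      refine (h.le_mul y (hx.trans hxy)).trans
        ((mul_le_mul_of_nonneg_left hy (by positivity)).trans_eq ?_)
      field_simp
    rw [le_div_iff₀ (sub_pos.2 hy1)]
    nlinarith [mul_nonneg hp0 (hx.trans hxy)]
  have : IsFiniteMeasure
      (ENNReal.ofReal (p / 2) • (volume : Measure ℝ).restrict (Ioc 0 (1 / (2 * M)))) :=
    Measure.smul_finite _ ENNReal.ofReal_ne_top
  have hle := measure_le_of_forall_Icc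
    (ρ := ENNReal.ofReal (p / 2) • volume.restrict (Ioc 0 (1 / (2 * M)))) (ν := ν) ?_ B
  · rwa [Measure.smul_apply, Measure.restrict_apply hB, smul_eq_mul] at hle
  intro c d hcd
  rw [Measure.smul_apply, Measure.restrict_apply measurableSet_Icc, smul_eq_mul]
  have hsub : Icc c d ∩ Ioc 0 (1 / (2 * M)) ⊆ Icc (max c 0) (min d (1 / (2 * M))) :=
    fun x hx => ⟨max_le hx.1.1 hx.2.1.le, le_min hx.1.2 hx.2.2⟩
  refine (mul_le_mul_right (measure_mono hsub) _).trans ?_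
  rcases lt_or_ge (min d (1 / (2 * M))) (max c 0) with hlt | hge
  · rw [Icc_eq_empty hlt.not_ge, measure_empty, mul_zero]
    exact zero_le
  · rw [Real.volume_Icc, ← ENNReal.ofReal_mul (by positivity)]
    refine le_trans (ENNReal.ofReal_le_ofReal
      (hincr _ _ (le_max_right c 0) hge (min_le_right _ _))) ?_
    rw [← measureReal_Ioc hge, ofReal_measureReal]
    exact measure_mono fun x hx =>
      ⟨(le_max_left c 0).trans hx.1.le, hx.2.trans (min_le_left _ _)⟩

variable (T) in
/-- The cylinders of order `n`, indexed by words of length `n`. -/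
def wordCyl {n : ℕ} (w : Fin n → ℕ) : Set ℝ := T.cyl (fun k => if h : k < n then w ⟨k, h⟩ else 0) n

lemma mem_wordCyl {n : ℕ} {w : Fin n → ℕ} {x : ℝ} :
    x ∈ T.wordCyl w ↔ ∀ k : Fin n, T.map^[k] x ∈ T.branch (w k) := by
  refine ⟨fun h k => ?_, fun h k hk => ?_⟩
  · simpa using h k k.2
  · simpa [hk] using h ⟨k, hk⟩

lemma disjoint_wordCyl {n : ℕ} {w w' : Fin n → ℕ} (h : w ≠ w') :
    Disjoint (T.wordCyl w) (T.wordCyl w') :=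
  disjoint_left.2 fun _ hx hx' =>
    h (funext fun k => eq_of_mem_branch (mem_wordCyl.1 hx k) (mem_wordCyl.1 hx' k))

variable (T) in
lemma ae_exists_mem_wordCyl (n : ℕ) : ∀ᵐ x ∂leb, ∃ w : Fin n → ℕ, x ∈ T.wordCyl w := by
  have h : ∀ᵐ x ∂leb, ∀ k : ℕ, T.map^[k] x ∈ T.dom := ae_all_iff.2 fun k =>
    (T.quasiMeasurePreserving_map.iterate k).ae (mem_ae_iff.2 T.leb_compl_dom)
  filter_upwards [h] with x hx
  choose i hi using fun k => mem_iUnion.1 (hx k)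
  exact ⟨fun k => i k, mem_wordCyl.2 fun k => hi k⟩

/-- A lower bound for relative measures in cylinders extends to all sets. -/
lemma mul_leb_le_of_cyl {A : Set ℝ} {β : ENNReal} (hβ : β ≠ ⊤)
    (h : ∀ i n, β * leb (T.cyl i n) ≤ leb.restrict A (T.cyl i n)) (s : Set ℝ) :
    β * leb s ≤ leb.restrict A s := by
  have : IsFiniteMeasure (β • (leb : Measure ℝ)) := Measure.smul_finite _ hβ
  refine measure_le_of_forall_Icc (ρ := β • leb) (ν := leb.restrict A) (fun c d _ => ?_) s
  rw [Measure.smul_apply, smul_eq_mul]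
  have hn : ∀ n, β * leb (Icc c d) ≤
      leb.restrict A (Icc c d) + β * (leb (T.sameCyl c n) + leb (T.sameCyl d n)) := fun n => by
    set W : Set (Fin n → ℕ) := {w | T.wordCyl w ⊆ Icc c d}
    have hcover : leb (Icc c d) ≤
        leb (⋃ w ∈ W, T.wordCyl w) + (leb (T.sameCyl c n) + leb (T.sameCyl d n)) := by
      refine (measure_mono_ae ?_).trans ((measure_union_le (⋃ w ∈ W, T.wordCyl w)
        (T.sameCyl c n ∪ T.sameCyl d n)).trans (add_le_add le_rfl (measure_union_le _ _)))
      filter_upwards [T.ae_exists_mem_wordCyl n] with x ⟨w, hw⟩ hx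
      have hsame : ∀ e ∈ T.wordCyl w, x ∈ T.sameCyl e n := fun e he k hk => ⟨_, hw k hk, he k hk⟩
      by_cases hwW : w ∈ W
      · exact Or.inl (mem_biUnion hwW hw)
      · obtain ⟨y, hy, hyJ⟩ := not_subset.1 hwW
        have hord := (ordConnected_cyl (T := T) (fun k => if h : k < n then w ⟨k, h⟩ else 0) n).1
        rcases lt_or_ge y c with hyc | hyc
        · exact Or.inr (Or.inl (hsame c (hord.out hy hw ⟨hyc.le, hx.1⟩)))
        · have hyd : d < y := not_le.1 fun hyd => hyJ ⟨hyc, hyd⟩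
          exact Or.inr (Or.inr (hsame d (hord.out hw hy ⟨hx.2, hyd.le⟩)))
    have hdisj : W.PairwiseDisjoint T.wordCyl := fun w _ w' _ hne => disjoint_wordCyl hne
    have hmeas : ∀ w ∈ W, MeasurableSet (T.wordCyl w) := fun w _ => measurableSet_cyl _ _
    have hgood : β * leb (⋃ w ∈ W, T.wordCyl w) ≤ leb.restrict A (Icc c d) := by
      calc β * leb (⋃ w ∈ W, T.wordCyl w)
          = ∑' w : W, β * leb (T.wordCyl w.1) := by
            rw [measure_biUnion W.to_countable hdisj hmeas, ENNReal.tsum_mul_left]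
        _ ≤ ∑' w : W, leb.restrict A (T.wordCyl w.1) := ENNReal.tsum_le_tsum fun w => h _ _
        _ = leb.restrict A (⋃ w ∈ W, T.wordCyl w) :=
            (measure_biUnion W.to_countable hdisj hmeas).symm
        _ ≤ leb.restrict A (Icc c d) := measure_mono (iUnion₂_subset fun w hw => hw)
    calc β * leb (Icc c d) ≤ β * (leb (⋃ w ∈ W, T.wordCyl w) +
          (leb (T.sameCyl c n) + leb (T.sameCyl d n))) := mul_le_mul_right hcover β
      _ ≤ _ := by
        rw [mul_add]
        exact add_le_add hgood le_rfl
  have hlim : Tendsto (fun n => leb.restrict A (Icc c d) +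
      β * (leb (T.sameCyl c n) + leb (T.sameCyl d n))) atTop (𝓝 (leb.restrict A (Icc c d))) := by
    have h0 := (tendsto_leb_sameCyl (T := T) c).add (tendsto_leb_sameCyl (T := T) d)
    have h1 := (ENNReal.Tendsto.const_mul h0 (Or.inr hβ)).const_add (leb.restrict A (Icc c d))
    simpa using h1
  exact ge_of_tendsto' hlim hn

lemma leb_compl_eq_zero_of_frequently {M : ℝ} (hM : 1 ≤ M)
    (hbound : ∀ (ν : Measure ℝ) (L : ℝ), HasDecreasingDensity ν L → 0 < ν.real univ →
      ∀ᶠ n in atTop, HasDecreasingDensity (ν.map T.map^[n]) (M * ν.real univ))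
    {A : Set ℝ} (hA : MeasurableSet A) {B : ℕ → Set ℝ} (hB : ∀ n, MeasurableSet (B n))
    (hAB : ∀ n, A =ᵐ[leb] T.map^[n] ⁻¹' B n) {η : ℝ} (hη : 0 < η)
    (hfreq : ∃ᶠ n in atTop, ENNReal.ofReal η ≤ volume (B n ∩ Ioc 0 (1 / (2 * M)))) :
    leb Aᶜ = 0 := by
  have hcyl : ∀ i n, ENNReal.ofReal (η / 2) * leb (T.cyl i n) ≤ leb.restrict A (T.cyl i n) := by
    intro i k
    rcases (measureReal_nonneg (μ := leb) (s := T.cyl i k)).eq_or_lt with h0 | hpos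
    · rw [eq_comm, measureReal_eq_zero_iff] at h0
      rw [h0, mul_zero]
      exact zero_le
    obtain ⟨L, hL⟩ := exists_hasDecreasingDensity_cylPush (T := T) i k
    have hev := hbound _ L hL (by rwa [cylPush_real_univ])
    obtain ⟨N, hN⟩ := eventually_atTop.1 hev
    obtain ⟨n, hn, hvol⟩ := frequently_atTop.1 hfreq (N + k)
    obtain ⟨m, rfl⟩ := Nat.exists_eq_add_of_le' ((Nat.le_add_left k N).trans hn)
    have hdec := hN m (by omega)
    have hle := HasDecreasingDensity.le_measure (ν := (T.cylPush i k).map T.map^[m]) hM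
      (by rwa [measureReal_univ_map_iterate]) (B (m + k)) (hB _)
    rw [measureReal_univ_map_iterate, cylPush_real_univ, cylPush,
      Measure.map_map (T.measurable_map.iterate m) (T.measurable_map.iterate k),
      ← Function.iterate_add, Measure.map_apply (T.measurable_map.iterate _) (hB _)] at hle
    have hswap : leb.restrict A (T.cyl i k) =
        leb.restrict (T.cyl i k) (T.map^[m + k] ⁻¹' B (m + k)) := by
      rw [Measure.restrict_apply (μ := leb) (s := A) (measurableSet_cyl i k), inter_comm,
        ← Measure.restrict_apply (μ := leb) (s := T.cyl i k) hA]
      exact measure_congr ((hAB (m + k)).filter_mono (ae_mono Measure.restrict_le_self))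
    rw [hswap]
    refine le_trans ?_ hle
    refine le_trans (le_of_eq ?_) (mul_le_mul_right hvol _)
    rw [← ofReal_measureReal, ← ENNReal.ofReal_mul (by positivity),
      ← ENNReal.ofReal_mul (by positivity)]
    congr 1
    ring
  have h := mul_leb_le_of_cyl ENNReal.ofReal_ne_top hcyl Aᶜ
  rw [Measure.restrict_apply (μ := leb) (s := A) hA.compl, compl_inter_self, measure_empty] at h
  rcases mul_eq_zero.1 (le_antisymm h zero_le) with h0 | h0
  · exact absurd (ENNReal.ofReal_eq_zero.1 h0) (by linarith)
  · exact h0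

/-- Lebesgue measure is exact for every map of the class. -/
lemma leb_exact {A : Set ℝ} (hA : MeasurableSet A)
    (h : ∀ n, ∃ B, MeasurableSet B ∧ A =ᵐ[leb] T.map^[n] ⁻¹' B) : leb A = 0 ∨ leb Aᶜ = 0 := by
  obtain ⟨M, hM, -, hbound⟩ := T.exists_uniform_bound
  choose B hB hAB using h
  have hM0 : 0 < M := one_pos.trans_le hM
  have hη : 0 < 1 / (2 * M) / 2 := by positivity
  have hdich : ∀ n, ENNReal.ofReal (1 / (2 * M) / 2) ≤ volume (B n ∩ Ioc 0 (1 / (2 * M))) ∨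
      ENNReal.ofReal (1 / (2 * M) / 2) ≤ volume ((B n)ᶜ ∩ Ioc 0 (1 / (2 * M))) := fun n => by
    by_contra! hlt
    have hsum := ENNReal.add_lt_add hlt.1 hlt.2
    rw [← ENNReal.ofReal_add hη.le hη.le, add_halves, inter_comm, inter_comm (B n)ᶜ, ← sdiff_eq,
      measure_inter_add_sdiff _ (hB n), Real.volume_Ioc, sub_zero] at hsum
    exact hsum.false
  rcases frequently_or_distrib.1
    (Eventually.frequently (f := atTop) (Eventually.of_forall hdich)) with hf | hf
  · exact Or.inr (leb_compl_eq_zero_of_frequently hM hbound hA hB hAB hη hf)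
  · left
    rw [← compl_compl A]
    exact leb_compl_eq_zero_of_frequently hM hbound hA.compl (fun n => (hB n).compl)
      (fun n => (hAB n).compl) hη hf

/-- The Cesàro averages of a real sequence. -/
noncomputable def avg (u : ℕ → ℝ) (n : ℕ) : ℝ := (n + 1 : ℝ)⁻¹ * ∑ k ∈ Finset.range (n + 1), u k

lemma avg_mono {u v : ℕ → ℝ} (h : ∀ k, u k ≤ v k) (n : ℕ) : avg u n ≤ avg v n :=
  mul_le_mul_of_nonneg_left (Finset.sum_le_sum fun k _ => h k) (by positivity)

lemma avg_const (c : ℝ) (n : ℕ) : avg (fun _ => c) n = c := by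
  simp only [avg, Finset.sum_const, Finset.card_range, nsmul_eq_mul]
  push_cast
  field_simp

lemma avg_linear (t s : ℝ) (u v : ℕ → ℝ) (n : ℕ) :
    avg (fun k => t * u k + s * v k) n = t * avg u n + s * avg v n := by
  simp only [avg, Finset.sum_add_distrib, ← Finset.mul_sum]
  ring

lemma avg_sub (u v : ℕ → ℝ) (n : ℕ) : avg (fun k => u k - v k) n = avg u n - avg v n := by
  simp only [avg, Finset.sum_sub_distrib]
  ring

lemma tendsto_avg_succ_sub {u : ℕ → ℝ} (h : ∀ k, u k ∈ Icc (0 : ℝ) 1) :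
    Tendsto (fun n => avg (fun k => u (k + 1)) n - avg u n) atTop (𝓝 0) := by
  refine squeeze_zero_norm (fun n => ?_) tendsto_one_div_add_atTop_nhds_zero_nat
  rw [← avg_sub, avg, Finset.sum_range_sub, norm_mul, norm_inv, one_div, Real.norm_eq_abs,
    Real.norm_eq_abs, abs_of_pos (by positivity : (0 : ℝ) < n + 1)]
  refine mul_le_of_le_one_right (by positivity) (abs_le.2 ⟨?_, ?_⟩)
  · linarith [(h (n + 1)).1, (h 0).2]
  · linarith [(h (n + 1)).2, (h 0).1]

variable (T) in
/-- There is a concave distribution function which is invariant under the map. -/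
lemma exists_invariant_distribution : ∃ (G : ℝ → ℝ) (M : ℝ), ConcaveOn ℝ (Ici 0) G ∧ G 0 = 0 ∧
    (∀ x, 1 ≤ x → G x = 1) ∧ Monotone G ∧
    (∀ x y, 0 ≤ x → x ≤ y → G y - G x ≤ M * (y - x)) ∧
    ∀ x, 0 ≤ x → HasSum (fun i => G (T.inv i x) - G (T.a i)) (G x) := by
  obtain ⟨M, -, hM, -⟩ := T.exists_uniform_bound
  set F : ℕ → ℝ → ℝ := fun k x => (leb.map T.map^[k]).real (Iic x) with hF
  have hfin : ∀ k, IsFiniteMeasure (leb.map T.map^[k]) := fun k => (hM k).finite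
  have huniv : ∀ k, (leb.map T.map^[k]).real univ = 1 := fun k => by
    rw [measureReal_univ_map_iterate]
    simp [measureReal_def]
  have hmem : ∀ k x, F k x ∈ Icc (0 : ℝ) 1 := fun k x =>
    ⟨measureReal_nonneg, (measureReal_mono (subset_univ _)).trans_eq (huniv k)⟩
  have hone : ∀ k x, 1 ≤ x → F k x = 1 := fun k x hx =>
    (measureReal_Iic_eq_univ (hM k).ac hx).trans (huniv k)
  have hzero : ∀ k, F k 0 = 0 := fun k => by
    simp [hF, measureReal_def, measure_Iic_eq_zero (hM k).ac le_rfl]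
  have hmono : ∀ k, Monotone (F k) := fun k => monotone_measureReal_Iic
  have hG : ∀ x, ∃ y, Tendsto (avg fun k => F k x) (hyperfilter ℕ) (𝓝 y) := fun x => by
    have hle : (((hyperfilter ℕ).map (avg fun k => F k x) : Ultrafilter ℝ) : Filter ℝ) ≤
        𝓟 (Icc 0 1) := by
      refine tendsto_principal.2 (Eventually.of_forall fun n => ⟨?_, ?_⟩)
      · exact (avg_const 0 n).symm.trans_le (avg_mono (fun k => (hmem k x).1) n)
      · exact (avg_mono (fun k => (hmem k x).2) n).trans_eq (avg_const 1 n)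
    obtain ⟨y, -, hy⟩ := isCompact_Icc.ultrafilter_le_nhds _ hle
    exact ⟨y, hy⟩
  choose G hG using hG
  have hGmono : Monotone G := fun x y hxy =>
    le_of_tendsto_of_tendsto' (hG x) (hG y) (avg_mono fun k => hmono k hxy)
  have hGlip : ∀ x y, 0 ≤ x → x ≤ y → G y - G x ≤ M * (y - x) := fun x y hx hxy => by
    refine le_of_tendsto' ((hG y).sub (hG x)) fun n => ?_
    rw [← avg_sub]
    exact (avg_mono (fun k => (hM k).sub_le hx hxy) n).trans_eq (avg_const _ n)
  refine ⟨G, M, ⟨convex_Ici 0, fun x hx y hy t s ht hs hts => ?_⟩, ?_, fun x hx => ?_, hGmono,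
    hGlip, fun x hx => ?_⟩
  · refine le_of_tendsto_of_tendsto' (((hG x).const_mul t).add ((hG y).const_mul s)) (hG _)
      fun n => ?_
    rw [← avg_linear]
    exact avg_mono (fun k => (hM k).concave.2 hx hy ht hs hts) n
  · refine tendsto_nhds_unique (hG 0) ?_
    simp only [hzero]
    exact tendsto_const_nhds.congr fun n => (avg_const 0 n).symm
  · refine tendsto_nhds_unique (hG x) ?_
    simp only [hone _ x hx]
    exact tendsto_const_nhds.congr fun n => (avg_const 1 n).symm
  · have hM0 : 0 ≤ M := (hM 0).nonneg
    have hbound : ∀ i, M * (T.inv i x - T.a i) ≤ M * x * (1 / T.da i) := fun i =>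
      (mul_le_mul_of_nonneg_left (T.inv_sub_a_le i hx) hM0).trans_eq (by ring)
    have hsum : Summable fun i => M * x * (1 / T.da i) := T.sum_inv.mul_left _
    have hstep : ∀ n, HasSum (fun i => avg (fun k => F k (T.inv i x)) n -
        avg (fun k => F k (T.a i)) n) (avg (fun k => F (k + 1) x) n) := fun n => by
      simp only [← avg_sub]
      refine HasSum.mul_left _ (hasSum_sum fun k _ => ?_)
      simp only [hF, map_iterate_succ]
      exact hasSum_map_Iic (hM k).ac hx
    have hlim : Tendsto (fun n => avg (fun k => F (k + 1) x) n) (hyperfilter ℕ) (𝓝 (G x)) := by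
      have h0 := ((tendsto_avg_succ_sub fun k => hmem k x).mono_left
        Nat.hyperfilter_le_atTop).add (hG x)
      simpa using h0
    have htsum := tendsto_tsum_of_dominated_convergence (𝓕 := hyperfilter ℕ)
      (f := fun n i => avg (fun k => F k (T.inv i x)) n - avg (fun k => F k (T.a i)) n) hsum
      (fun i => (hG (T.inv i x)).sub (hG (T.a i))) (Eventually.of_forall fun n i => by
        rw [← avg_sub, Real.norm_eq_abs, abs_of_nonneg ((avg_const 0 n).symm.trans_le
          (avg_mono (fun k => sub_nonneg.2 (hmono k (T.a_le_inv i hx))) n))]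
        exact le_trans ((avg_mono (fun k => (hM k).sub_le (T.a_nonneg i) (T.a_le_inv i hx))
          n).trans_eq (avg_const _ n)) (hbound i))
    simp only [(hstep _).tsum_eq] at htsum
    rw [tendsto_nhds_unique hlim htsum]
    refine (Summable.of_nonneg_of_le (fun i => sub_nonneg.2 (hGmono (T.a_le_inv i hx)))
      (fun i => ?_) hsum).hasSum
    exact (hGlip _ _ (T.a_nonneg i) (T.a_le_inv i hx)).trans (hbound i)

/-- A concave Lipschitz distribution function is the integral of a bounded antitone density. -/
lemma exists_antitone_density {G : ℝ → ℝ} {M : ℝ} (hc : ConcaveOn ℝ (Ici 0) G) (h0 : G 0 = 0)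
    (hmono : Monotone G) (hlip : ∀ x y, 0 ≤ x → x ≤ y → G y - G x ≤ M * (y - x)) :
    ∃ h : ℝ → ℝ, (∀ x, 0 ≤ h x) ∧ (∀ x, h x ≤ M) ∧ Antitone h ∧
      ∀ x, 0 ≤ x → ∫ y in (0)..x, h y = G x := by
  have hintg : ∀ x, 0 < x → x ∈ interior (Ici (0 : ℝ)) := fun x hx => by rwa [interior_Ici]
  have hdiff : ∀ x, 0 < x → HasDerivWithinAt G (derivWithin G (Ioi x) x) (Ioi x) x :=
    fun x hx => by
      have h := (hc.neg.differentiableWithinAt_Ioi_of_mem_interior (hintg x hx)).neg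
      rw [neg_neg] at h
      exact h.hasDerivWithinAt
  have hslope : ∀ x y, 0 ≤ x → x < y → slope G x y ∈ Icc 0 M := fun x y hx hxy => by
    rw [slope_def_field]
    exact ⟨div_nonneg (sub_nonneg.2 (hmono hxy.le)) (sub_pos.2 hxy).le,
      (div_le_iff₀ (sub_pos.2 hxy)).2 (hlip x y hx hxy.le)⟩
  have hrange : ∀ x, 0 < x → derivWithin G (Ioi x) x ∈ Icc 0 M := fun x hx => by
    have ht := hasDerivWithinAt_iff_tendsto_slope' self_notMem_Ioi |>.1 (hdiff x hx)
    refine isClosed_Icc.mem_of_tendsto ht ?_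
    filter_upwards [self_mem_nhdsWithin] with y hy using hslope x y hx.le hy
  have hM0 : 0 ≤ M := (hrange 1 one_pos).1.trans (hrange 1 one_pos).2
  set h : ℝ → ℝ := fun x => if x ≤ 0 then M else derivWithin G (Ioi x) x with hh
  have hpos : ∀ x, 0 < x → h x = derivWithin G (Ioi x) x := fun x hx => if_neg hx.not_ge
  have hnonpos : ∀ x, x ≤ 0 → h x = M := fun x hx => if_pos hx
  have hmem : ∀ x, h x ∈ Icc 0 M := fun x => by
    rcases le_or_gt x 0 with hx | hx
    · rw [hnonpos x hx]
      exact right_mem_Icc.2 hM0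
    · rw [hpos x hx]
      exact hrange x hx
  have hanti : Antitone h := fun x y hxy => by
    rcases le_or_gt x 0 with hx | hx
    · rw [hnonpos x hx]
      exact (hmem y).2
    · rw [hpos x hx, hpos y (hx.trans_le hxy)]
      have hneg := hc.neg.monotoneOn_rightDeriv (hintg x hx) (hintg y (hx.trans_le hxy)) hxy
      simpa [derivWithin.neg] using hneg
  refine ⟨h, fun x => (hmem x).1, fun x => (hmem x).2, hanti, fun x hx => ?_⟩
  have hcont : ContinuousOn G (Icc 0 x) := by
    refine (LipschitzOnWith.of_dist_le_mul (K := M.toNNReal) fun y hy z hz => ?_).continuousOn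
    rw [Real.coe_toNNReal M hM0, Real.dist_eq, Real.dist_eq]
    rcases le_total y z with hyz | hyz
    · rw [abs_sub_comm, abs_sub_comm y, abs_of_nonneg (sub_nonneg.2 (hmono hyz)),
        abs_of_nonneg (sub_nonneg.2 hyz)]
      exact hlip y z hy.1 hyz
    · rw [abs_of_nonneg (sub_nonneg.2 (hmono hyz)), abs_of_nonneg (sub_nonneg.2 hyz)]
      exact hlip z y hz.1 hyz
  rw [intervalIntegral.integral_eq_sub_of_hasDeriv_right_of_le hx hcont
    (fun y hy => (hpos y hy.1).symm ▸ hdiff y hy.1) hanti.intervalIntegrable, h0, sub_zero]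

lemma withDensity_leb_apply {h : ℝ → ℝ} (hanti : Antitone h) (h0 : ∀ x, 0 ≤ h x) {A : Set ℝ}
    (hA : MeasurableSet A) : (leb.withDensity fun x => ENNReal.ofReal (h x)) A =
      ENNReal.ofReal (∫ x in A ∩ Icc (0 : ℝ) 1, h x) := by
  have hintg : IntegrableOn h (A ∩ Icc 0 1) :=
    ((hanti.antitoneOn _).integrableOn_isCompact isCompact_Icc).mono_set inter_subset_right
  rw [withDensity_apply _ hA, Measure.restrict_restrict hA,
    ofReal_integral_eq_lintegral_ofReal hintg (Eventually.of_forall h0)]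

variable (T) in
/-- The map preserves a probability measure with bounded non-increasing density. -/
lemma exists_invariant_density : ∃ (h : ℝ → ℝ) (M : ℝ), (∀ x, 0 ≤ h x) ∧ (∀ x, h x ≤ M) ∧
    Antitone h ∧ IsProbabilityMeasure (leb.withDensity fun x => ENNReal.ofReal (h x)) ∧
    (leb.withDensity fun x => ENNReal.ofReal (h x)).map T.map =
      leb.withDensity fun x => ENNReal.ofReal (h x) := by
  obtain ⟨G, M, hc, hG0, hG1, hmono, hlip, hsum⟩ := T.exists_invariant_distribution
  obtain ⟨h, h0, hM, hanti, hintg⟩ := exists_antitone_density hc hG0 hmono hlip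
  set μ : Measure ℝ := leb.withDensity fun x => ENNReal.ofReal (h x) with hμ
  have hac : μ ≪ leb := withDensity_absolutelyContinuous _ _
  have hIic : ∀ x, 0 ≤ x → μ (Iic x) = ENNReal.ofReal (G x) := fun x hx => by
    have hset : Iic x ∩ Icc 0 1 = Icc 0 (min x 1) := by
      ext y
      simp only [mem_inter_iff, mem_Iic, mem_Icc, le_min_iff]
      tauto
    have hGmin : G x = G (min x 1) := by
      rcases le_total x 1 with h1 | h1
      · rw [min_eq_left h1]
      · rw [min_eq_right h1, hG1 x h1, hG1 1 le_rfl]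
    rw [withDensity_leb_apply hanti h0 measurableSet_Iic, hset, integral_Icc_eq_integral_Ioc,
      ← intervalIntegral.integral_of_le (le_min hx zero_le_one),
      hintg _ (le_min hx zero_le_one), hGmin]
  have hprob : IsProbabilityMeasure μ := by
    refine ⟨?_⟩
    have hfull : μ (Iic 1) = μ univ := by
      refine measure_congr (eventuallyEq_univ.2 (hac ?_))
      rw [Measure.restrict_apply measurableSet_Iic.compl]
      convert measure_empty (μ := volume)
      exact disjoint_iff_inter_eq_empty.1
        (disjoint_compl_left_iff_subset.2 fun y hy => hy.2)
    rw [← hfull, hIic 1 zero_le_one, hG1 1 le_rfl, ENNReal.ofReal_one]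
  have hreal : ∀ x, 0 ≤ x → μ.real (Iic x) = G x := fun x hx => by
    rw [measureReal_def, hIic x hx, ENNReal.toReal_ofReal (hG0.symm.trans_le (hmono hx))]
  refine ⟨h, M, h0, hM, hanti, hprob, Measure.ext_of_Iic _ _ fun x => ?_⟩
  rcases lt_or_ge x 0 with hx | hx
  · rw [measure_Iic_eq_zero (map_absolutelyContinuous hac) hx.le, measure_Iic_eq_zero hac hx.le]
  · have hmap := hasSum_map_Iic (T := T) hac hx
    simp only [hreal _ (T.inv_nonneg _ hx), hreal _ (T.a_nonneg _)] at hmap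
    rw [← ofReal_measureReal (μ := μ), ← ofReal_measureReal (μ := μ.map T.map), hreal x hx,
      hmap.unique (hsum x hx)]

variable (T) in
lemma ae_iterate_eq : ∀ᵐ x ∂leb, ∀ n : ℕ, T.τ^[n] x = T.map^[n] x := by
  have h : ∀ᵐ x ∂leb, ∀ k : ℕ, T.map^[k] x ∈ T.dom := ae_all_iff.2 fun k =>
    (T.quasiMeasurePreserving_map.iterate k).ae (mem_ae_iff.2 T.leb_compl_dom)
  filter_upwards [h] with x hx n
  induction n with
  | zero => rfl
  | succ n ih => rw [Function.iterate_succ_apply', Function.iterate_succ_apply', ih,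
      T.map_of_mem (hx n)]

lemma preimage_inter_ae_eq (n : ℕ) (A : Set ℝ) :
    (T.τ^[n] ⁻¹' A ∩ Icc 0 1 : Set ℝ) =ᵐ[leb] T.map^[n] ⁻¹' A := by
  filter_upwards [T.ae_iterate_eq, ae_restrict_mem measurableSet_Icc] with x hx hmem
  refine propext ⟨fun h => ?_, fun h => ⟨?_, hmem⟩⟩
  · exact (hx n ▸ h.1 : T.map^[n] x ∈ A)
  · exact (congrArg (· ∈ A) (hx n)).mpr h

/-- For measures on the unit interval, invariance under `τ` is invariance under its measurable
modification. -/
lemma map_eq_self_iff (hν : ν ≪ leb) : ν.map T.map = ν ↔ ∀ A : Set ℝ, MeasurableSet A →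
    ν (T.τ ⁻¹' A ∩ Icc 0 1) = ν (A ∩ Icc 0 1) := by
  have h1 : ∀ A : Set ℝ, ν (T.τ ⁻¹' A ∩ Icc 0 1) = ν (T.map ⁻¹' A) := fun A =>
    measure_congr (hν.ae_eq (preimage_inter_ae_eq 1 A))
  have h0 : ∀ A : Set ℝ, ν (A ∩ Icc 0 1) = ν A := fun A =>
    measure_congr (hν.ae_eq (preimage_inter_ae_eq (T := T) 0 A))
  simp only [h1, h0, Measure.ext_iff]
  exact forall₂_congr fun A hA => by rw [Measure.map_apply T.measurable_map hA]

lemma ergodic_of_map_eq_self (hν : ν ≪ leb) (hinv : ν.map T.map = ν) : Ergodic T.map ν := by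
  refine ⟨⟨T.measurable_map, hinv⟩, ⟨fun s hs hinvs => ?_⟩⟩
  have hn : ∀ n, T.map^[n] ⁻¹' s = s := fun n => by
    rw [preimage_iterate_eq]
    exact Function.IsFixedPt.iterate hinvs n
  rw [eventuallyConst_set']
  rcases leb_exact (T := T) hs fun n => ⟨s, hs, (hn n).symm ▸ EventuallyEq.rfl⟩ with h | h
  · exact Or.inl (ae_eq_empty.2 (hν h))
  · exact Or.inr (eventuallyEq_univ.2 (hν h))

/-- Two absolutely continuous invariant probability measures agree. -/
lemma eq_of_map_eq_self {μ : Measure ℝ} [IsProbabilityMeasure μ] [IsProbabilityMeasure ν]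
    (hμ : μ ≪ leb) (hν : ν ≪ leb) (hμinv : μ.map T.map = μ) (hνinv : ν.map T.map = ν) :
    ν = μ := by
  set ρ : Measure ℝ := (2⁻¹ : ENNReal) • (μ + ν) with hρ
  have hρac : ρ ≪ leb := (Measure.smul_absolutelyContinuous).trans
    (Measure.AbsolutelyContinuous.add_left hμ hν)
  have hρinv : ρ.map T.map = ρ := by
    rw [hρ, Measure.map_smul, Measure.map_add _ _ T.measurable_map, hμinv, hνinv]
  have hρprob : IsProbabilityMeasure ρ := ⟨by
    rw [hρ, Measure.smul_apply, Measure.add_apply, measure_univ, measure_univ, smul_eq_mul,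
      one_add_one_eq_two, ENNReal.inv_mul_cancel two_ne_zero ENNReal.ofNat_ne_top]⟩
  have herg := ergodic_of_map_eq_self hρac hρinv
  have hac : μ + ν ≪ ρ :=
    Measure.absolutelyContinuous_smul (ENNReal.inv_ne_zero.2 ENNReal.ofNat_ne_top)
  rw [herg.eq_of_absolutelyContinuous ⟨T.measurable_map, hμinv⟩
      ((Measure.le_add_right le_rfl).absolutelyContinuous.trans hac),
    herg.eq_of_absolutelyContinuous ⟨T.measurable_map, hνinv⟩
      ((Measure.le_add_left le_rfl).absolutelyContinuous.trans hac)]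

lemma tail_trivial {μ : Measure ℝ} [IsProbabilityMeasure μ] (hμ : μ ≪ leb) {A : Set ℝ}
    (hA : ∀ n : ℕ, ∃ B : Set ℝ, MeasurableSet B ∧
      A ∩ Icc 0 1 = T.τ^[n] ⁻¹' B ∩ Icc 0 1) : μ A = 0 ∨ μ A = 1 := by
  have hAB : ∀ n, ∃ B, MeasurableSet B ∧ A =ᵐ[leb] T.map^[n] ⁻¹' B := fun n => by
    obtain ⟨B, hB, hAB⟩ := hA n
    refine ⟨B, hB, ?_⟩
    have h := preimage_inter_ae_eq (T := T) n B
    rw [← hAB] at h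
    exact (preimage_inter_ae_eq (T := T) 0 A).symm.trans h
  obtain ⟨B, hB, hAB0⟩ := hAB 0
  have hAB0' : A =ᵐ[leb] B := hAB0
  rw [measure_congr (hμ.ae_eq hAB0')]
  rcases leb_exact (T := T) hB fun n => (hAB n).imp fun C hC => ⟨hC.1, hAB0'.symm.trans hC.2⟩
    with h | h
  · exact Or.inl (hμ h)
  · exact Or.inr ((prob_compl_eq_zero_iff hB).1 (hμ h))

end PCT

/-- Theorem 2.2.9. Let `τ ∈ 𝒯`. Then there exists a unique absolutely
continuous `τ`-invariant probability measure `μ` on `I`; the system `(I, 𝓑, μ, τ)` is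
exact (every set in `⋂ₙ τ⁻ⁿ(𝓑)` has `μ`-measure `0` or `1`); and the density
`h = dμ/dm` is bounded and non-increasing. -/
theorem exists_unique_acim_exact_decreasing_density (T : PCT) :
    ∃ μ : MeasureTheory.Measure ℝ, MeasureTheory.IsProbabilityMeasure μ ∧
      μ ≪ volume ∧ μ (Set.Icc (0:ℝ) 1)ᶜ = 0 ∧
      (∀ A : Set ℝ, MeasurableSet A →
        μ (T.τ ⁻¹' A ∩ Set.Icc 0 1) = μ (A ∩ Set.Icc 0 1)) ∧
      (∀ ν : MeasureTheory.Measure ℝ, MeasureTheory.IsProbabilityMeasure ν →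
        ν ≪ volume → ν (Set.Icc (0:ℝ) 1)ᶜ = 0 →
        (∀ A : Set ℝ, MeasurableSet A →
          ν (T.τ ⁻¹' A ∩ Set.Icc 0 1) = ν (A ∩ Set.Icc 0 1)) → ν = μ) ∧
      (∀ A : Set ℝ, (∀ n : ℕ, ∃ B : Set ℝ, MeasurableSet B ∧
          A ∩ Set.Icc 0 1 = T.τ^[n] ⁻¹' B ∩ Set.Icc 0 1) → μ A = 0 ∨ μ A = 1) ∧
      (∃ h : ℝ → ℝ, (∀ x ∈ Set.Icc (0:ℝ) 1, 0 ≤ h x) ∧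
        (∃ M : ℝ, ∀ x ∈ Set.Icc (0:ℝ) 1, h x ≤ M) ∧
        AntitoneOn h (Set.Icc (0:ℝ) 1) ∧
        (∀ A : Set ℝ, MeasurableSet A →
          μ A = ENNReal.ofReal (∫ x in A ∩ Set.Icc (0:ℝ) 1, h x))) := by
  have hleb : ∀ ν : Measure ℝ, ν ≪ volume → ν (Icc (0 : ℝ) 1)ᶜ = 0 → ν ≪ PCT.leb :=
    fun ν hν h0 => by
      rw [← Measure.restrict_eq_self_of_ae_mem (mem_ae_iff.2 h0)]
      exact hν.restrict _
  obtain ⟨h, M, h0, hM, hanti, hprob, hinv⟩ := T.exists_invariant_density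
  set μ : Measure ℝ := PCT.leb.withDensity fun x => ENNReal.ofReal (h x)
  have hac : μ ≪ PCT.leb := withDensity_absolutelyContinuous _ _
  refine ⟨μ, hprob, hac.trans Measure.restrict_le_self.absolutelyContinuous, hac ?_,
    (PCT.map_eq_self_iff hac).1 hinv, fun ν hν hνvol hν0 hνinv => ?_, fun A hA =>
    PCT.tail_trivial hac hA, h, fun x _ => h0 x, ⟨M, fun x _ => hM x⟩, hanti.antitoneOn _,
    fun A hA => PCT.withDensity_leb_apply hanti h0 hA⟩
  · rw [Measure.restrict_apply measurableSet_Icc.compl, compl_inter_self, measure_empty]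
  · have hνac := hleb ν hνvol hν0
    exact PCT.eq_of_map_eq_self hac hνac hinv ((PCT.map_eq_self_iff hνac).2 hνinv)
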